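/- arXiv:2302.08922 — 4 statements merged into one kernel-verified Lean document; each statement's English description precedes it below -/
import Mathlib

section
/- For every finite rooted tree (T, r) and every integer t ≥ 1, there exists a constant c (depending only on T, r and t) such that every graph G that contains no clique of size t and admits no path-induced copy of (T, r) has chromatic number at most c. -/
open SimpleGraph

/-- A walk `p` in `G` is an *induced path* if it is a path and two vertices on it are
adjacent in `G` exactly when they are consecutive on the walk. -/
def IsInducedPathWalk {V : Type*} (G : SimpleGraph V) {a b : V} (p : G.Walk a b) : Prop :=
  p.IsPath ∧ ∀ i j : Fin p.support.length,
    G.Adj (p.support.get i) (p.support.get j) ↔ ((i : ℕ) + 1 = (j : ℕ) ∨ (j : ℕ) + 1 = (i : ℕ))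

/-- A *path-induced copy* of a rooted tree `(T, r)` in `G`: an injective graph homomorphism
`φ : T →g G` such that the image of every path of `T` with one end `r` is an induced path
of `G`. -/
def IsPathInducedCopy {α W : Type*} (T : SimpleGraph α) (r : α) (G : SimpleGraph W)
    (φ : T →g G) : Prop :=
  Function.Injective φ ∧
    ∀ (v : α) (p : T.Walk r v), p.IsPath → IsInducedPathWalk G (p.map φ)

/-- The subgraph of `G` induced on `X` has a proper colouring with colours `0, …, c - 1`. -/
def ColorableOn {V : Type*} (G : SimpleGraph V) (X : Set V) (c : ℕ) : Prop :=
  ∃ col : V → ℕ, (∀ v ∈ X, col v < c) ∧ ∀ u ∈ X, ∀ v ∈ X, G.Adj u v → col u ≠ col v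

/-- `v` is the root of a tree of induced paths of `G`, of height `h` and branching at least `d`,
all of whose vertices other than `v` lie in `S`. Distinct branches may share vertices. -/
def IsBranchingRoot {V : Type*} (G : SimpleGraph V) (d : ℕ) : Set V → ℕ → V → Prop
  | _, 0, _ => True
  | S, h + 1, v => ∃ A : Finset V, d ≤ A.card ∧ ∀ u ∈ A, u ∈ S ∧ G.Adj v u ∧
      IsBranchingRoot G d {w ∈ S | ¬ G.Adj v w ∧ w ≠ v} h u

section Coloring

variable {V : Type*} {G : SimpleGraph V}

theorem IsBranchingRoot.mono {d h : ℕ} {S S' : Set V} {v : V} (hS : S ⊆ S')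
    (hv : IsBranchingRoot G d S h v) : IsBranchingRoot G d S' h v := by
  induction h generalizing S S' v with
  | zero => trivial
  | succ h ih =>
    obtain ⟨A, hA, hAS⟩ := hv
    exact ⟨A, hA, fun u hu => ⟨hS (hAS u hu).1, (hAS u hu).2.1,
      ih (fun w hw => ⟨hS hw.1, hw.2⟩) (hAS u hu).2.2⟩⟩

theorem ColorableOn.mono {X Y : Set V} {c : ℕ} (hXY : X ⊆ Y) (hY : ColorableOn G Y c) :
    ColorableOn G X c := by
  obtain ⟨col, h1, h2⟩ := hY
  exact ⟨col, fun v hv => h1 v (hXY hv), fun u hu v hv => h2 u (hXY hu) v (hXY hv)⟩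

theorem ColorableOn.union {X Y : Set V} {a b : ℕ} (hX : ColorableOn G X a)
    (hY : ColorableOn G Y b) : ColorableOn G (X ∪ Y) (a + b) := by
  classical
  obtain ⟨f, f1, f2⟩ := hX
  obtain ⟨g, g1, g2⟩ := hY
  refine ⟨fun v => if v ∈ X then f v else a + g v, ?_, ?_⟩
  · rintro v hv
    dsimp only
    split_ifs with h
    · have := f1 v h
      omega
    · have := g1 v (hv.resolve_left h)
      omega
  · intro u hu v hv huv
    dsimp only
    split_ifs with h h' h'
    · exact f2 u h v h' huv
    · have := f1 u h
      omega
    · have := f1 v h'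
      omega
    · have := g2 u (hu.resolve_left h) v (hv.resolve_left h') huv
      omega

theorem colorableOn_mul {X : Set V} {k c : ℕ} (g : V → ℕ) (hg : ∀ v ∈ X, g v < k)
    (hX : ∀ i, ColorableOn G {v ∈ X | g v = i} c) : ColorableOn G X (k * c) := by
  choose col h1 h2 using hX
  have hlt : ∀ v ∈ X, col (g v) v < c := fun v hv => h1 _ v ⟨hv, rfl⟩
  refine ⟨fun v => g v * c + col (g v) v, fun v hv => ?_, fun u hu v hv huv heq => ?_⟩
  · have := hlt v hv
    have h3 : (g v + 1) * c ≤ k * c := Nat.mul_le_mul_right c (hg v hv)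
    rw [Nat.add_mul] at h3
    dsimp only
    omega
  · dsimp only at heq
    have hu' := hlt u hu
    have hv' := hlt v hv
    have hc : 0 < c := by omega
    have hguv : g u = g v := by
      have := congrArg (· / c) heq
      simpa [Nat.add_comm, Nat.add_mul_div_right _ _ hc, Nat.div_eq_of_lt hu',
        Nat.div_eq_of_lt hv'] using this
    refine h2 (g v) u ⟨hu, hguv⟩ v ⟨hv, rfl⟩ huv ?_
    rw [hguv] at heq
    omega

/-- A finite digraph whose arcs increase `f` and whose out-degrees are less than `d` is
`d`-colourable. -/
theorem exists_coloring_of_outdegree_lt {d : ℕ} (s : Finset V) (f : V → ℕ) (R : V → V → Prop)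
    (hf : ∀ x u, R x u → f x < f u)
    (hd : ∀ x ∈ s, ∀ A ⊆ s, (∀ u ∈ A, R x u) → A.card < d) :
    ∃ col : V → ℕ, (∀ v ∈ s, col v < d) ∧ ∀ x ∈ s, ∀ u ∈ s, R x u → col x ≠ col u := by
  classical
  induction s using Finset.induction_on_min_value f with
  | empty => exact ⟨fun _ => 0, by simp, by simp⟩
  | insert a s ha hmin ih =>
    have hsub := Finset.subset_insert a s
    obtain ⟨col, h1, h2⟩ := ih fun x hx A hA => hd x (hsub hx) A (hA.trans hsub)
    have hcard : ((s.filter (R a)).image col).card < (Finset.range d).card := by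
      rw [Finset.card_range]
      exact Finset.card_image_le.trans_lt (hd a
        (Finset.mem_insert_self a s) _ ((Finset.filter_subset _ _).trans hsub) (by simp))
    obtain ⟨i, hi, hi'⟩ := Finset.exists_mem_notMem_of_card_lt_card hcard
    have hne : ∀ v ∈ s, v ≠ a := fun v hv h => ha (h ▸ hv)
    refine ⟨Function.update col a i, ?_, ?_⟩
    · intro v hv
      rcases Finset.mem_insert.1 hv with rfl | hv
      · simpa using hi
      · simpa [hne v hv] using h1 v hv
    · intro x hx u hu hR
      rcases Finset.mem_insert.1 hx with rfl | hx' <;> rcases Finset.mem_insert.1 hu with rfl | hu'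
      · exact absurd (hf _ _ hR) (lt_irrefl _)
      · rw [Function.update_self, Function.update_of_ne (hne u hu')]
        exact fun h => hi' (h ▸ Finset.mem_image_of_mem _ (by simp [hu', hR]))
      · exact absurd (hf _ _ hR) (hmin x hx').not_gt
      · rw [Function.update_of_ne (hne x hx'), Function.update_of_ne (hne u hu')]
        exact h2 x hx' u hu' hR

theorem exists_injective_refining [Fintype V] (f : V → ℕ) :
    ∃ g : V → ℕ, Function.Injective g ∧ ∀ u v, f u < f v → g u < g v := by
  let e := Fintype.equivFin V
  have key : ∀ u v, f u < f v →
      f u * Fintype.card V + e u < f v * Fintype.card V + e v := by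
    intro u v huv
    have h3 : (f u + 1) * Fintype.card V ≤ f v * Fintype.card V := Nat.mul_le_mul_right _ huv
    rw [Nat.add_mul] at h3
    have := (e u).isLt
    omega
  refine ⟨fun v => f v * Fintype.card V + e v, fun u v huv => ?_, key⟩
  rcases lt_trichotomy (f u) (f v) with h | h | h
  · exact absurd huv (key u v h).ne
  · simp only [h, Nat.add_left_cancel_iff] at huv
    exact e.injective (Fin.ext huv)
  · exact absurd huv (key v u h).ne'

end Coloring

/-- If the levels of `f` and the neighbourhoods have bounded chromatic number, and no vertex is a
branching root towards the vertices of larger level, then the chromatic number is bounded. -/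
theorem exists_colorableOn_of_levels (d σ h : ℕ) : ∀ τ : ℕ, ∃ c : ℕ,
    ∀ (V : Type) [Fintype V] (G : SimpleGraph V) (X : Set V) (f : V → ℕ),
      (∀ v ∈ X, ColorableOn G {w ∈ X | G.Adj v w} σ) →
      (∀ i, ColorableOn G {v ∈ X | f v = i} τ) →
      (∀ v ∈ X, ¬ IsBranchingRoot G d {w ∈ X | f v < f w} h v) →
      ColorableOn G X c := by
  induction h with
  | zero =>
    exact fun τ => ⟨0, fun V _ G X f _ _ hX =>
      ⟨fun _ => 0, fun v hv => absurd trivial (hX v hv), fun v hv => absurd trivial (hX v hv)⟩⟩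
  | succ h ih =>
    intro τ
    obtain ⟨c, hc⟩ := ih σ
    refine ⟨d * (τ + c), fun V _ G X f hσ hτ hX => ?_⟩
    classical
    obtain ⟨col, hcol, hR⟩ := exists_coloring_of_outdegree_lt (d := d) X.toFinset f
      (fun x u => f x < f u ∧ G.Adj x u ∧
        IsBranchingRoot G d {w ∈ X | f x < f w ∧ ¬ G.Adj x w ∧ w ≠ x} h u)
      (fun x u hxu => hxu.1) (fun x hx A hAX hA => by
        by_contra! hcard
        refine hX x (Set.mem_toFinset.1 hx) ⟨A, hcard, fun u hu => ?_⟩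
        obtain ⟨hlt, hadj, hgood⟩ := hA u hu
        exact ⟨⟨Set.mem_toFinset.1 (hAX hu), hlt⟩, hadj,
          hgood.mono fun w hw => ⟨⟨hw.1, hw.2.1⟩, hw.2.2⟩⟩)
    simp only [Set.mem_toFinset] at hcol hR
    refine colorableOn_mul col hcol fun i => ?_
    set Y : Set V := {v ∈ X | col v = i} with hY
    obtain ⟨g, hginj, hgf⟩ := exists_injective_refining f
    set E : V → Set ℕ := fun x => {n | ∃ y ∈ Y, G.Adj y x ∧ f y < f x ∧ g y = n} with hE
    have hsplit : Y ⊆ {v ∈ Y | ¬ (E v).Nonempty} ∪ {v ∈ Y | (E v).Nonempty} := fun v hv =>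
      (em (E v).Nonempty).elim (fun hv' => Or.inr ⟨hv, hv'⟩) (fun hv' => Or.inl ⟨hv, hv'⟩)
    refine ColorableOn.mono hsplit (ColorableOn.union ?_ ?_)
    · choose lc h1 h2 using hτ
      refine ⟨fun v => lc (f v) v, fun v hv => h1 _ v ⟨hv.1.1, rfl⟩, fun u hu v hv huv => ?_⟩
      rcases lt_trichotomy (f u) (f v) with hlt | heq | hlt
      · exact absurd (⟨g u, u, hu.1, huv, hlt, rfl⟩ : (E v).Nonempty) hv.2
      · dsimp only
        rw [heq]
        exact h2 _ u ⟨hu.1.1, heq⟩ v ⟨hv.1.1, rfl⟩ huv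
      · exact absurd (⟨g v, v, hv.1, huv.symm, hlt, rfl⟩ : (E u).Nonempty) hu.2
    · refine hc V G {v ∈ Y | (E v).Nonempty} (fun x => sInf (E x)) (fun v hv => ?_) (fun n => ?_)
        (fun x hx hgood => ?_)
      · refine (hσ v hv.1.1).mono ?_
        exact fun w hw => ⟨hw.1.1.1, hw.2⟩
      · rcases Set.eq_empty_or_nonempty {v ∈ {v ∈ Y | (E v).Nonempty} | sInf (E v) = n} with
          hem | ⟨x, hx, hxn⟩
        · rw [hem]
          exact ⟨fun _ => 0, by simp, by simp⟩
        · obtain ⟨y, hyY, -, -, hgy⟩ := Nat.sInf_mem hx.2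
          refine (hσ y hyY.1).mono ?_
          rintro w ⟨hw, hwn⟩
          obtain ⟨z, -, hzw, -, hgz⟩ := Nat.sInf_mem hw.2
          obtain rfl : z = y := hginj (by rw [hgz, hgy, hwn, hxn])
          exact ⟨hw.1.1, hzw⟩
      · obtain ⟨y, hyY, hyx, hfyx, hgy⟩ := Nat.sInf_mem hx.2
        refine hR y hyY.1 x hx.1.1 ⟨hfyx, hyx, hgood.mono ?_⟩ (hyY.2.trans hx.1.2.symm)
        rintro w ⟨hw, hlt⟩
        obtain ⟨z, -, -, hfzw, hgz⟩ := Nat.sInf_mem hw.2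
        have hgyz : g y < g z := by
          rw [hgy, hgz]
          exact hlt
        have hfyw : f y < f w :=
          (not_lt.1 fun h => (hgf z y h).not_gt hgyz).trans_lt hfzw
        refine ⟨hw.1.1, hfyw, fun hyw => ?_, fun h => (h ▸ hfyw).false⟩
        have : sInf (E w) ≤ g y := Nat.sInf_le ⟨y, hyY, hyw, hfyw, rfl⟩
        omega

theorem exists_colorableOn_of_not_isBranchingRoot (d h t : ℕ) : ∃ c : ℕ,
    ∀ (V : Type) [Fintype V] (G : SimpleGraph V) (X : Set V), G.CliqueFreeOn X t →
      (∀ v ∈ X, ¬ IsBranchingRoot G d X h v) → ColorableOn G X c := by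
  induction t with
  | zero => exact ⟨0, fun V _ G X hX _ => absurd (hX (t := ∅) (by simp)) (by simp)⟩
  | succ t ih =>
    obtain ⟨σ, hσ⟩ := ih
    obtain ⟨c, hc⟩ := exists_colorableOn_of_levels d σ h 1
    refine ⟨c, fun V _ G X hX hroot => ?_⟩
    obtain ⟨g, hg, -⟩ := exists_injective_refining fun _ : V => 0
    refine hc V G X g (fun v hv => ?_) (fun i => ?_) (fun v hv hgood => ?_)
    · exact hσ V G _ (CliqueFreeOn.of_succ G hX hv) fun w hw hgood =>
        hroot w hw.1 (hgood.mono fun _ hu => hu.1)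
    · refine ⟨fun _ => 0, by simp, fun u hu v hv huv => absurd (hg (hu.2.trans hv.2.symm)) huv.ne⟩
    · exact hroot v hv (hgood.mono fun _ hu => hu.1)

/-- Greedy embedding of a finite rooted tree, given by its parent and depth functions, into the
tree of induced paths below a branching root. -/
theorem IsBranchingRoot.exists_embedding {α V : Type*} [Fintype α] {G : SimpleGraph V} {d N : ℕ}
    {v : V} (hv : IsBranchingRoot G d Set.univ N v) (hd : Fintype.card α ≤ d) {r : α}
    (par : α → α) (dep : α → ℕ) (hdep : ∀ a, dep a ≤ N) (hr : dep r = 0) (hparr : par r = r)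
    (hpar : ∀ a, a ≠ r → dep a = dep (par a) + 1) :
    ∃ (φ : α → V) (S : α → Set V), Function.Injective φ ∧ ∀ a, a ≠ r →
      φ a ∈ S (par a) ∧ G.Adj (φ (par a)) (φ a) ∧
        S a = {w ∈ S (par a) | ¬ G.Adj (φ (par a)) w ∧ w ≠ φ (par a)} := by
  classical
  suffices H : ∀ s : Finset α, (∀ a ∈ s, par a ∈ s) → ∃ (φ : α → V) (S : α → Set V),
      Set.InjOn φ s ∧ (∀ a ∈ s, IsBranchingRoot G d (S a) (N - dep a) (φ a)) ∧
      ∀ a ∈ s, a ≠ r → φ a ∈ S (par a) ∧ G.Adj (φ (par a)) (φ a) ∧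
        S a = {w ∈ S (par a) | ¬ G.Adj (φ (par a)) w ∧ w ≠ φ (par a)} by
    obtain ⟨φ, S, h1, -, h3⟩ := H Finset.univ (by simp)
    exact ⟨φ, S, by simpa using h1, fun a => h3 a (Finset.mem_univ a)⟩
  intro s
  induction s using Finset.induction_on_max_value dep with
  | empty => exact fun _ => ⟨fun _ => v, fun _ => Set.univ, by simp, by simp, by simp⟩
  | insert a s ha hmax ih =>
    intro hs
    have hne : ∀ b ∈ s, b ≠ a := fun b hb h => ha (h ▸ hb)
    have hzero : a = r → s = ∅ := by
      rintro rfl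
      refine Finset.eq_empty_of_forall_notMem fun b hb => ?_
      have h1 := hmax b hb
      have h2 := hpar b (hne b hb)
      omega
    by_cases har : a = r
    · obtain rfl := hzero har
      subst har
      refine ⟨fun _ => v, fun _ => Set.univ, by simp, ?_, ?_⟩
      · simpa [hr] using hv
      · intro b hb hb'
        simp at hb
        exact absurd hb hb'
    have hclosed : ∀ b ∈ s, par b ∈ s := by
      intro b hb
      refine (Finset.mem_insert.1 (hs b (Finset.mem_insert_of_mem hb))).resolve_left fun h => ?_
      by_cases hbr : b = r
      · rw [hbr, hparr] at h
        exact har h.symm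
      · have h1 := hpar b hbr
        have h2 := hmax b hb
        rw [h] at h1
        omega
    have hpa : par a ∈ s := by
      refine (Finset.mem_insert.1 (hs a (Finset.mem_insert_self a s))).resolve_left fun h => ?_
      have h1 := hpar a har
      rw [h] at h1
      omega
    obtain ⟨φ, S, h1, h2, h3⟩ := ih hclosed
    have hgood := h2 _ hpa
    have hN : N - dep (par a) = (N - dep a) + 1 := by
      have := hdep a
      have := hpar a har
      omega
    rw [hN] at hgood
    obtain ⟨A, hA, hAS⟩ := hgood
    have hcard : (s.image φ).card < A.card :=
      (Finset.card_image_le.trans_lt (Finset.card_lt_univ_of_notMem ha)).trans_le (hd.trans hA)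
    obtain ⟨u, huA, hu⟩ := Finset.exists_mem_notMem_of_card_lt_card hcard
    obtain ⟨huS, hadj, hu'⟩ := hAS u huA
    have hφ : ∀ b ∈ s, Function.update φ a u b = φ b :=
      fun b hb => Function.update_of_ne (hne b hb) _ _
    refine ⟨Function.update φ a u, Function.update S a
      {w ∈ S (par a) | ¬ G.Adj (φ (par a)) w ∧ w ≠ φ (par a)}, ?_, ?_, ?_⟩
    · rw [Finset.coe_insert, Set.injOn_insert (by simpa using ha)]
      refine ⟨fun x hx y hy hxy => h1 hx hy ?_, ?_⟩
      · rwa [hφ x hx, hφ y hy] at hxy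
      · rintro ⟨b, hb, hbu⟩
        rw [hφ b hb, Function.update_self] at hbu
        exact hu (hbu ▸ Finset.mem_image_of_mem φ hb)
    · intro b hb
      rcases Finset.mem_insert.1 hb with rfl | hb
      · simpa using hu'
      · simpa [hne b hb] using h2 b hb
    · intro b hb hbr
      rcases Finset.mem_insert.1 hb with rfl | hb
      · simpa [hne _ hpa] using ⟨huS, hadj⟩
      · simpa [hne b hb, hne _ (hclosed b hb)] using h3 b hb hbr

/-- Parent and depth functions of a finite rooted tree. -/
theorem SimpleGraph.IsTree.exists_parent {α : Type*} [Fintype α] {T : SimpleGraph α}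
    (hT : T.IsTree) (r : α) : ∃ (par : α → α) (dep : α → ℕ), (∀ a, dep a ≤ Fintype.card α) ∧
      dep r = 0 ∧ par r = r ∧ (∀ a, a ≠ r → dep a = dep (par a) + 1) ∧
      (∀ a b, T.Adj a b → a = par b ∧ b ≠ r ∨ b = par a ∧ a ≠ r) ∧
      ∀ (v : α) (p : T.Walk r v), p.IsPath → ∀ i < p.length,
        p.getVert (i + 1) ≠ r ∧ par (p.getVert (i + 1)) = p.getVert i := by
  choose P hP huniq using fun a => hT.existsUnique_path r a
  have hPr : P r = Walk.nil := (huniq r _ Walk.IsPath.nil).symm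
  have hstep : ∀ (v : α) (p : T.Walk r v), p.IsPath → ∀ i < p.length,
      p.getVert (i + 1) ≠ r ∧ (P (p.getVert (i + 1))).penultimate = p.getVert i := by
    intro v p hp i hi
    have htake := huniq _ _ (hp.take (i + 1))
    refine ⟨fun h => ?_, ?_⟩
    · have := hp.getVert_injOn (x₁ := i + 1) (x₂ := 0) hi (Nat.zero_le _) (by simpa using h)
      omega
    · rw [← htake, Walk.penultimate, Walk.take_length, Walk.take_getVert]
      congr 1
      omega
  have hdepth : ∀ a, a ≠ r → (P a).length = (P (P a).penultimate).length + 1 := by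
    intro a ha
    have hpos : 0 < (P a).length := Nat.pos_of_ne_zero fun h => ha (Walk.eq_of_length_eq_zero h).symm
    have htake := huniq _ _ ((hP a).take ((P a).length - 1))
    have := congrArg Walk.length htake
    rw [Walk.take_length] at this
    rw [Walk.penultimate]
    omega
  refine ⟨fun a => (P a).penultimate, fun a => (P a).length, fun a => (hP a).length_lt.le,
    by simp [hPr], by simp [hPr], hdepth, fun a b hab => ?_, hstep⟩
  have key : ∀ a b, T.Adj a b → b ∉ (P a).support → a = (P b).penultimate ∧ b ≠ r := by
    intro a b hab hb
    have := huniq b _ ((hP a).concat hb hab)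
    refine ⟨by rw [← this, Walk.penultimate_concat], ?_⟩
    rintro rfl
    exact hb (Walk.start_mem_support _)
  by_cases hb : b ∈ (P a).support
  · exact Or.inr (key b a hab.symm
      (hT.2.ne_mem_support_of_support_of_adj_of_isPath (hP a) (hP b) hab hb))
  · exact Or.inl (key a b hab hb)

theorem IsBranchingRoot.exists_isPathInducedCopy {α V : Type*} [Fintype α] {T : SimpleGraph α}
    (hT : T.IsTree) (r : α) {G : SimpleGraph V} {v : V}
    (hv : IsBranchingRoot G (Fintype.card α) Set.univ (Fintype.card α) v) :
    ∃ φ : T →g G, IsPathInducedCopy T r G φ := by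
  obtain ⟨par, dep, hdep, hr, hparr, hpar, hadj, hpath⟩ := hT.exists_parent r
  obtain ⟨φ, S, hinj, hφ⟩ := hv.exists_embedding le_rfl par dep hdep hr hparr hpar
  refine ⟨⟨φ, fun {a b} hab => ?_⟩, hinj, fun w p hp =>
    ⟨hp.map hinj, fun i j => ?_⟩⟩
  · rcases hadj a b hab with ⟨rfl, hb⟩ | ⟨rfl, ha⟩
    · exact (hφ b hb).2.1
    · exact (hφ a ha).2.1.symm
  have hnext : ∀ i < p.length, φ (p.getVert (i + 1)) ∈ S (p.getVert i) ∧
      G.Adj (φ (p.getVert i)) (φ (p.getVert (i + 1))) ∧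
      S (p.getVert (i + 1)) = {w ∈ S (p.getVert i) | ¬ G.Adj (φ (p.getVert i)) w ∧
        w ≠ φ (p.getVert i)} := by
    intro i hi
    obtain ⟨h1, h2⟩ := hpath w p hp i hi
    simpa only [h2] using hφ _ h1
  have hanti : ∀ i k, i + k ≤ p.length → S (p.getVert (i + k)) ⊆ S (p.getVert i) := by
    intro i k
    induction k with
    | zero => exact fun _ => subset_rfl
    | succ k ih =>
      intro hk
      rw [← add_assoc, (hnext (i + k) (by omega)).2.2]
      exact (Set.sep_subset _ _).trans (ih (by omega))
  have hlt : ∀ i j, i < j → j ≤ p.length →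
      (G.Adj (φ (p.getVert i)) (φ (p.getVert j)) ↔ i + 1 = j) := by
    intro i j hij hj
    refine ⟨fun hadj => ?_, ?_⟩
    · by_contra hne
      obtain ⟨k, rfl⟩ : ∃ k, j = i + 1 + k + 1 := ⟨j - i - 2, by omega⟩
      have hmem := hanti (i + 1) k (by omega) (hnext (i + 1 + k) (by omega)).1
      rw [(hnext i (by omega)).2.2] at hmem
      exact hmem.2.1 hadj
    · rintro rfl
      exact (hnext i (by omega)).2.1
  have hi : (i : ℕ) ≤ p.length := by
    have := i.isLt
    simp at this
    omega
  have hj : (j : ℕ) ≤ p.length := by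
    have := j.isLt
    simp at this
    omega
  simp only [List.get_eq_getElem, Walk.support_getElem_eq_getVert, Walk.getVert_map]
  change G.Adj (φ (p.getVert i)) (φ (p.getVert j)) ↔ _
  rcases lt_trichotomy (i : ℕ) j with h | h | h
  · rw [hlt _ _ h hj]
    omega
  · simp [h]
  · rw [G.adj_comm, hlt _ _ h hi]
    omega

/-- For every finite rooted tree `(T, r)` and every integer `t ≥ 1`, there is a constant
`c` such that every (finite) graph `G` with no clique of size `t` and no path-induced
copy of `(T, r)` has chromatic number at most `c`. -/
theorem gyarfas_sumner_path_induced {α : Type} [Fintype α]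
    (T : SimpleGraph α) (hT : T.IsTree) (r : α) (t : ℕ) (ht : 1 ≤ t) :
    ∃ c : ℕ, ∀ (V : Type) [Fintype V] (G : SimpleGraph V),
      G.CliqueFree t →
      (¬ ∃ φ : T →g G, IsPathInducedCopy T r G φ) →
      G.chromaticNumber ≤ (c : ℕ∞) := by
  obtain ⟨c, hc⟩ := exists_colorableOn_of_not_isBranchingRoot (Fintype.card α) (Fintype.card α) t
  refine ⟨c, fun V _ G hG hcopy => ?_⟩
  obtain ⟨col, h1, h2⟩ := hc V G Set.univ ((cliqueFreeOn_univ G).2 hG)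
    fun v _ hv => hcopy (hv.exists_isPathInducedCopy hT r)
  exact Colorable.chromaticNumber_le ⟨Coloring.mk (fun v => (⟨col v, h1 v trivial⟩ : Fin c))
    fun {u v} huv h => h2 u trivial v trivial huv (congrArg Fin.val h)⟩
end

section
/- For all integers a, c ≥ 0, if G is a graph with χ(G) > a·c, and X ⊆ V(G) is a c-creature of G with χ(G[X]) ≤ a, then χ(G \ X) = χ(G), where G \ X denotes the subgraph of G induced on V(G) \ X. -/
open SimpleGraph

/-- `X` is a `c`-creature of `G` if every vertex in `X` has fewer than `c` neighbours
outside `X`. -/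
def IsCreature {V : Type*} (G : SimpleGraph V) (c : ℕ) (X : Set V) : Prop :=
  ∀ v ∈ X, (G.neighborSet v \ X).ncard < c

/-- Vertices of the rooted tree `T_d^k`: a vertex at depth `j ≤ k` is a list
`[a_j, …, a_1]` of child labels read from the vertex up to the root, where the label
`a_1` of a child of the root lies in `{0, …, d-1}` (the root has `d` children) and all
other labels lie in `{0, …, d-2}` (each non-root internal vertex has `d-1` children,
hence degree `d`). -/
def TdkVertex (d k : ℕ) : Type :=
  {l : List ℕ // l.length ≤ k ∧ (∀ x ∈ l, x < d) ∧ ∀ x ∈ l.dropLast, x < d - 1}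

/-- The tree `T_d^k`: the root has degree `d`, every vertex has degree `d` or `1`, and
every root-to-leaf path has length `k`.  Two vertices are adjacent iff one is obtained
from the other by prepending one child label. -/
def Tdk (d k : ℕ) : SimpleGraph (TdkVertex d k) :=
  SimpleGraph.fromRel (fun u v => ∃ a : ℕ, v.val = a :: u.val)

/-- The root of `T_d^k`. -/
def TdkRoot (d k : ℕ) : TdkVertex d k :=
  ⟨[], by simp⟩

/-- A colouring of the complement of a `c`-creature `X` extends to the whole graph, with no new
colours, if `X` is `a`-colourable and at least `a * c` colours are available. -/
theorem IsCreature.colorable_of_induce_compl {V : Type*} [Finite V] {G : SimpleGraph V}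
    {a c m : ℕ} {X : Set V} (hX : IsCreature G c X) (hXa : (G.induce X).Colorable a)
    (hXm : (G.induce Xᶜ).Colorable m) (hm : a * c ≤ m) : G.Colorable m := by
  classical
  obtain ⟨f⟩ := hXa
  obtain ⟨g⟩ := hXm
  let e : Fin a × Fin c → Fin m := fun p => Fin.castLE hm (finProdFinEquiv p)
  have he : Function.Injective e := (Fin.castLE_injective hm).comp finProdFinEquiv.injective
  have free (v : X) : ∃ j : Fin c, ∀ w : (Xᶜ : Set V), G.Adj v w → g w ≠ e (f v, j) := by
    by_contra! hused
    choose w hadj hw using hused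
    have hinj : Function.Injective fun j => (w j : V) := by
      intro i j hij
      have h : e (f v, i) = e (f v, j) := by rw [← hw i, ← hw j, Subtype.ext hij]
      exact (Prod.ext_iff.mp (he h)).2
    have hcard : c ≤ (G.neighborSet v \ X).ncard := by
      calc c = (Set.range fun j => (w j : V)).ncard := by
            rw [← Set.image_univ, Set.ncard_image_of_injective _ hinj, Set.ncard_univ,
              Nat.card_fin]
        _ ≤ _ := Set.ncard_le_ncard (by
            rintro _ ⟨j, rfl⟩
            exact ⟨hadj j, (w j).2⟩) (Set.toFinite _)
    exact (hX v v.2).not_ge hcard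
  choose j hj using free
  refine ⟨Coloring.mk
    (fun v => if h : v ∈ X then e (f ⟨v, h⟩, j ⟨v, h⟩) else g ⟨v, h⟩) ?_⟩
  intro u v huv
  by_cases hu : u ∈ X <;> by_cases hv : v ∈ X <;> simp only [hu, hv, dite_true, dite_false]
  · intro h
    exact f.valid (v := ⟨u, hu⟩) (w := ⟨v, hv⟩) huv (Prod.ext_iff.mp (he h)).1
  · exact (hj ⟨u, hu⟩ ⟨v, hv⟩ huv).symm
  · exact hj ⟨v, hv⟩ ⟨u, hu⟩ huv.symm
  · exact g.valid (v := ⟨u, hu⟩) (w := ⟨v, hv⟩) huv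

/-- If `χ(G) > a·c` and `X` is a `c`-creature of `G` with `χ(G[X]) ≤ a`, then deleting
`X` does not change the chromatic number. -/
theorem creature_deletion {V : Type} [Fintype V] (G : SimpleGraph V) (a c : ℕ) (X : Set V)
    (hchi : ((a * c : ℕ) : ℕ∞) < G.chromaticNumber)
    (hX : IsCreature G c X)
    (hXchi : (G.induce X).chromaticNumber ≤ (a : ℕ∞)) :
    (G.induce Xᶜ).chromaticNumber = G.chromaticNumber := by
  apply le_antisymm
  · exact chromaticNumber_le_of_forall_imp fun _ hc => hc.of_hom (Embedding.induce Xᶜ).toHom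
  · refine chromaticNumber_le_of_forall_imp fun n hn => ?_
    have hmax : G.Colorable (max n (a * c)) :=
      hX.colorable_of_induce_compl (chromaticNumber_le_iff_colorable.mp hXchi)
        (hn.mono (le_max_left _ _)) (le_max_right _ _)
    rcases le_total (a * c) n with h | h
    · rwa [max_eq_left h] at hmax
    · rw [max_eq_right h] at hmax
      exact absurd hmax.chromaticNumber_le hchi.not_ge
end

section
/- For every n ≥ 1, the complete bipartite graph K_{n,n} has minimum degree n, contains no clique of size 3, and admits no path-induced copy of (P_4, r), where P_4 is the four-vertex path and r is one of its ends. -/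
open SimpleGraph

attribute [local instance] Classical.propDecidable

/-- The complete bipartite graph with parts of equal size `n` is `n`-regular. -/
theorem SimpleGraph.isRegularOfDegree_completeBipartiteGraph (n : ℕ)
    [LocallyFinite (completeBipartiteGraph (Fin n) (Fin n))] :
    (completeBipartiteGraph (Fin n) (Fin n)).IsRegularOfDegree n := by
  intro v
  rw [← card_neighborSet_eq_degree, ← Nat.card_eq_fintype_card, Nat.card_coe_set_eq]
  rcases v with v | v
  · have h : (completeBipartiteGraph (Fin n) (Fin n)).neighborSet (.inl v) = Set.range .inr := by
      ext (w | w) <;> simp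
    rw [h, ← Set.image_univ, Set.ncard_image_of_injective _ Sum.inr_injective]
    simp
  · have h : (completeBipartiteGraph (Fin n) (Fin n)).neighborSet (.inr v) = Set.range .inl := by
      ext (w | w) <;> simp
    rw [h, ← Set.image_univ, Set.ncard_image_of_injective _ Sum.inl_injective]
    simp

/-- The ends of a walk of length three in a complete bipartite graph are adjacent. -/
theorem SimpleGraph.completeBipartiteGraph_adj_of_adj_adj_adj {V W : Type*} {a b c d : V ⊕ W}
    (hab : (completeBipartiteGraph V W).Adj a b) (hbc : (completeBipartiteGraph V W).Adj b c)
    (hcd : (completeBipartiteGraph V W).Adj c d) : (completeBipartiteGraph V W).Adj a d := by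
  rcases a with a | a <;> rcases b with b | b <;> rcases c with c | c <;> rcases d with d | d <;>
    simp_all

/-- For every `n ≥ 1`, the complete bipartite graph `K_{n,n}` has minimum degree `n`,
contains no clique of size `3`, and admits no path-induced copy of `(P_4, r)` where `r`
is an end of the four-vertex path `P_4`. -/
theorem knn_no_path_induced_P4 (n : ℕ) (hn : 1 ≤ n) :
    (completeBipartiteGraph (Fin n) (Fin n)).minDegree = n ∧
    (completeBipartiteGraph (Fin n) (Fin n)).CliqueFree 3 ∧
    ¬ ∃ φ : pathGraph 4 →g completeBipartiteGraph (Fin n) (Fin n),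
        IsPathInducedCopy (pathGraph 4) (0 : Fin 4) (completeBipartiteGraph (Fin n) (Fin n)) φ := by
  refine ⟨?_, ?_, ?_⟩
  · have : Nonempty (Fin n ⊕ Fin n) := ⟨.inl ⟨0, hn⟩⟩
    exact (isRegularOfDegree_completeBipartiteGraph n).minDegree_eq
  · exact (CompleteBipartiteGraph.bicoloring (Fin n) (Fin n)).colorable.cliqueFree (by simp)
  · rintro ⟨φ, -, hφ⟩
    have h₀₁ : (pathGraph 4).Adj 0 1 := by simp [pathGraph_adj]
    have h₁₂ : (pathGraph 4).Adj 1 2 := by simp [pathGraph_adj]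
    have h₂₃ : (pathGraph 4).Adj 2 3 := by simp [pathGraph_adj]
    have h := (hφ 3 (.cons h₀₁ (.cons h₁₂ (.cons h₂₃ .nil))) (by simp)).2
      ⟨0, by simp⟩ ⟨3, by simp⟩
    have h₀₃ := completeBipartiteGraph_adj_of_adj_adj_adj
      (φ.map_adj h₀₁) (φ.map_adj h₁₂) (φ.map_adj h₂₃)
    simpa using h.mp h₀₃
end

section
/- Let T be a finite tree with a vertex r, let d be an integer with d ≥ 2 and d at least the maximum degree of T, and let k be an integer with k ≥ 1 and k at least the maximum distance in T from r to any vertex. Then there is an injective graph homomorphism from T to T_d^k mapping r to the root of T_d^k. -/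
open SimpleGraph

/-- In a tree rooted at `r`, every vertex other than `r` has exactly one neighbour closer
to `r`, its parent. -/
lemma SimpleGraph.IsTree.exists_parent_s7 {V : Type*} {G : SimpleGraph V} (hG : G.IsTree) (r : V) :
    ∃ par : V → V, ∀ v, v ≠ r → ∀ u,
      (G.Adj v u ∧ G.dist r v = G.dist r u + 1) ↔ u = par v := by
  choose p hp using fun v => hG.connected.exists_path_of_dist r v
  refine ⟨fun v => (p v).penultimate, fun v hv u => ⟨?_, ?_⟩⟩
  · rintro ⟨hvu, hdist⟩
    have hq : ((p u).concat hvu.symm).IsPath := by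
      apply Walk.isPath_of_length_eq_dist
      rw [Walk.length_concat, (hp u).2, hdist]
    have := (hG.existsUnique_path r v).unique hq (hp v).1
    simp [← this]
  · rintro rfl
    have hnil : ¬ (p v).Nil := Walk.not_nil_of_ne hv.symm
    have hadj := (p v).adj_penultimate hnil
    refine ⟨hadj.symm, ?_⟩
    have hle : G.dist r (p v).penultimate ≤ (p v).length - 1 := by
      simpa using dist_le (p v).dropLast
    have hlen := (hp v).2
    rcases hG.dist_eq_dist_add_one_of_adj r hadj with h | h <;> omega

/-- The elements of a finite set can be numbered below its cardinality. -/
lemma Set.Finite.exists_injOn_nat_lt_ncard {α : Type*} {s : Set α} (hs : s.Finite) :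
    ∃ g : α → ℕ, Set.InjOn g s ∧ ∀ x ∈ s, g x < s.ncard := by
  obtain ⟨g, hg, hinj⟩ := hs.exists_injOn_of_encard_le (t := Set.Iio s.ncard) (by
    rw [← Finset.coe_Iio, Set.encard_coe_eq_coe_finsetCard, Nat.card_Iio, hs.cast_ncard_eq])
  exact ⟨g, hinj, fun x hx => hg hx⟩

/-- The first `n` labels met on the way up from a vertex, following the map `par`. -/
def ancestorLabels {α : Type*} (par : α → α) (lab : α → ℕ) : ℕ → α → List ℕ
  | 0, _ => []
  | n + 1, v => lab v :: ancestorLabels par lab n (par v)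

lemma length_ancestorLabels {α : Type*} (par : α → α) (lab : α → ℕ) (n : ℕ) (v : α) :
    (ancestorLabels par lab n v).length = n := by
  induction n generalizing v with
  | zero => rfl
  | succ n ih => simp [ancestorLabels, ih]

/-- Every finite tree `T` with a vertex `r` embeds (as an injective graph homomorphism,
root to root) into `T_d^k`, provided `d ≥ 2` is at least the maximum degree of `T` and
`k ≥ 1` is at least the maximum distance in `T` from `r` to any vertex. -/
theorem tree_hom_into_Tdk {α : Type} [Fintype α]
    (T : SimpleGraph α) (hT : T.IsTree) (r : α) (d k : ℕ)
    (hd : 2 ≤ d) (hdeg : ∀ v : α, (T.neighborSet v).ncard ≤ d)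
    (hk : 1 ≤ k) (hdist : ∀ v : α, T.dist r v ≤ k) :
    ∃ f : T →g Tdk d k, Function.Injective f ∧ f r = TdkRoot d k := by
  obtain ⟨par, hpar⟩ := hT.exists_parent_s7 r
  choose g hginj hglt using fun u : α =>
    (Set.toFinite {v | v ≠ r ∧ par v = u}).exists_injOn_nat_lt_ncard
  set lab : α → ℕ := fun v => g (par v) v with hlab
  have hpar_adj : ∀ v, v ≠ r → T.Adj v (par v) ∧ T.dist r v = T.dist r (par v) + 1 :=
    fun v hv => (hpar v hv _).2 rfl
  have hdist_zero : ∀ v, T.dist r v = 0 → v = r := fun v h =>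
    (hT.connected.dist_eq_zero_iff.1 h).symm
  have hne_root : ∀ v n, T.dist r v = n + 1 → v ≠ r := by
    rintro v n h rfl
    simp at h
  have hsub : ∀ u, {v | v ≠ r ∧ par v = u} ⊆ T.neighborSet u := by
    rintro u v ⟨hv, rfl⟩
    exact (hpar_adj v hv).1.symm
  have hlab_lt : ∀ v, v ≠ r → lab v < d := fun v hv =>
    (hglt (par v) v ⟨hv, rfl⟩).trans_le
      ((Set.ncard_le_ncard (hsub _) (Set.toFinite _)).trans (hdeg _))
  have hlab_lt' : ∀ v, v ≠ r → par v ≠ r → lab v < d - 1 := by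
    intro v hv hpv
    have hss : {w | w ≠ r ∧ par w = par v} ⊂ T.neighborSet (par v) := by
      refine (Set.ssubset_iff_of_subset (hsub _)).2 ⟨par (par v), (hpar_adj _ hpv).1, ?_⟩
      rintro ⟨hne, heq⟩
      have h1 := (hpar_adj _ hpv).2
      have h2 := (hpar_adj _ hne).2
      rw [heq] at h2
      omega
    have h1 := Set.ncard_lt_ncard hss (Set.toFinite _)
    have h2 := hglt (par v) v ⟨hv, rfl⟩
    have h3 := hdeg (par v)
    simp only [hlab]
    omega
  have hbound : ∀ n v, T.dist r v = n → ∀ x ∈ ancestorLabels par lab n v, x < d := by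
    intro n
    induction n with
    | zero => simp [ancestorLabels]
    | succ n ih =>
      intro v hv x hx
      have hvr := hne_root v n hv
      have hpv := (hpar_adj v hvr).2
      rcases List.mem_cons.1 hx with rfl | hx
      · exact hlab_lt v hvr
      · exact ih (par v) (by omega) x hx
  have hbound' : ∀ n v, T.dist r v = n →
      ∀ x ∈ (ancestorLabels par lab n v).dropLast, x < d - 1 := by
    intro n
    induction n with
    | zero => simp [ancestorLabels]
    | succ n ih =>
      intro v hv x hx
      have hvr := hne_root v n hv
      have hpv := (hpar_adj v hvr).2
      cases n with
      | zero => simp [ancestorLabels] at hx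
      | succ n =>
        rw [ancestorLabels, List.dropLast_cons_of_ne_nil (by simp [ancestorLabels])] at hx
        rcases List.mem_cons.1 hx with rfl | hx
        · exact hlab_lt' v hvr (hne_root _ n (by omega))
        · exact ih (par v) (by omega) x hx
  have hinj : ∀ n v w, T.dist r v = n → T.dist r w = n →
      ancestorLabels par lab n v = ancestorLabels par lab n w → v = w := by
    intro n
    induction n with
    | zero => exact fun v w hv hw _ => (hdist_zero v hv).trans (hdist_zero w hw).symm
    | succ n ih =>
      intro v w hv hw h
      have hvr := hne_root v n hv
      have hwr := hne_root w n hw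
      have hpv := (hpar_adj v hvr).2
      have hpw := (hpar_adj w hwr).2
      obtain ⟨h1, h2⟩ := List.cons.inj h
      have hp := ih (par v) (par w) (by omega) (by omega) h2
      simp only [hlab, hp] at h1
      exact hginj (par w) ⟨hvr, hp⟩ ⟨hwr, rfl⟩ h1
  let F : α → TdkVertex d k := fun v => ⟨ancestorLabels par lab (T.dist r v) v,
    by simpa only [length_ancestorLabels] using hdist v, hbound _ v rfl, hbound' _ v rfl⟩
  have hFinj : Function.Injective F := by
    intro v w h
    have hval : ancestorLabels par lab (T.dist r v) v = ancestorLabels par lab (T.dist r w) w :=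
      congrArg Subtype.val h
    have hlen : T.dist r v = T.dist r w := by
      simpa only [length_ancestorLabels] using congrArg List.length hval
    exact hinj _ v w rfl hlen.symm (by rwa [← hlen] at hval)
  have hcons : ∀ u v, T.Adj v u → T.dist r v = T.dist r u + 1 →
      ∃ a, (F v).val = a :: (F u).val := by
    intro u v hadj hvu
    obtain rfl := (hpar v (hne_root v _ hvu) u).1 ⟨hadj, hvu⟩
    refine ⟨lab v, ?_⟩
    simp only [F, hvu]
    rfl
  refine ⟨⟨F, fun {u v} huv => ?_⟩, hFinj, Subtype.ext ?_⟩
  · rw [Tdk, SimpleGraph.fromRel_adj]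
    refine ⟨hFinj.ne huv.ne, ?_⟩
    rcases hT.dist_eq_dist_add_one_of_adj r huv with h | h
    · exact Or.inr (hcons v u huv h)
    · exact Or.inl (hcons u v huv.symm h)
  · change ancestorLabels par lab (T.dist r r) r = []
    rw [dist_self]
    rfl
end
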